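/- Let n ≥ 3 be an integer and let s > (n−1)/(n−2). Let T₊ ∈ (0,∞] and let x, y : [0,T₊) → ℝ be twice continuously differentiable functions satisfying the system (S_s) with zero initial data, such that the solution cannot be extended: there is no T' > T₊ and no twice continuously differentiable solution of (S_s) on [0,T') with zero initial data. Then T₊ < ∞ and y(t) → −∞ as t → T₊ from the left. -/

import Mathlib

open Real Set Filter

/-- The ODE system (S_s):
`x'' = n − (1/s)(n−1)e^{−2x} − (n/2)((x')² + x'·y')` and
`y'' = n − (2 − 1/s)(n−1)e^{−2y} − (n/2)((y')² + x'·y')`, required at all points of `I`. -/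
def SysS (n : ℕ) (s : ℝ) (x y : ℝ → ℝ) (I : Set ℝ) : Prop :=
  ∀ t ∈ I,
    deriv (deriv x) t =
      (n : ℝ) - (1 / s) * ((n : ℝ) - 1) * Real.exp (-2 * x t)
        - ((n : ℝ) / 2) * ((deriv x t) ^ 2 + deriv x t * deriv y t) ∧
    deriv (deriv y) t =
      (n : ℝ) - (2 - 1 / s) * ((n : ℝ) - 1) * Real.exp (-2 * y t)
        - ((n : ℝ) / 2) * ((deriv y t) ^ 2 + deriv x t * deriv y t)

/-- Zero initial data: `x(0) = y(0) = x'(0) = y'(0) = 0`. -/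
def ZeroInit (x y : ℝ → ℝ) : Prop :=
  x 0 = 0 ∧ y 0 = 0 ∧ deriv x 0 = 0 ∧ deriv y 0 = 0


open Real Set Filter Topology

/-- Continuous on `[0,T)` with a given right derivative. -/
def RD (f f' : ℝ → ℝ) (T : ℝ) : Prop :=
  ContinuousOn f (Ico 0 T) ∧ ∀ t ∈ Ico 0 T, HasDerivWithinAt f (f' t) (Ici t) t

theorem RD.lt_bound {f f' : ℝ → ℝ} {T : ℝ} (h : RD f f' T) {B B' : ℝ → ℝ} (h0 : f 0 ≤ B 0)
    (hB : ∀ t, HasDerivAt B (B' t) t)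
    (bound : ∀ t ∈ Ico 0 T, f t = B t → f' t < B' t) : ∀ t ∈ Ico 0 T, f t ≤ B t := by
  intro t ht
  have hsub : Icc 0 t ⊆ Ico 0 T := fun r hr => ⟨hr.1, hr.2.trans_lt ht.2⟩
  exact image_le_of_deriv_right_lt_deriv_boundary (h.1.mono hsub)
    (fun r hr => h.2 r (hsub ⟨hr.1, hr.2.le⟩)) h0 hB
    (fun r hr => bound r (hsub ⟨hr.1, hr.2.le⟩)) ⟨ht.1, le_rfl⟩

theorem RD.le_bound {f f' : ℝ → ℝ} {T : ℝ} (h : RD f f' T) {B B' : ℝ → ℝ} (h0 : f 0 ≤ B 0)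
    (hB : ∀ t, HasDerivAt B (B' t) t)
    (bound : ∀ t ∈ Ico 0 T, f' t ≤ B' t) : ∀ t ∈ Ico 0 T, f t ≤ B t := by
  intro t ht
  have hsub : Icc 0 t ⊆ Ico 0 T := fun r hr => ⟨hr.1, hr.2.trans_lt ht.2⟩
  exact image_le_of_deriv_right_le_deriv_boundary (h.1.mono hsub)
    (fun r hr => h.2 r (hsub ⟨hr.1, hr.2.le⟩)) h0
    (fun x _ => (hB x).continuousAt.continuousWithinAt) (fun x _ => (hB x).hasDerivWithinAt)
    (fun r hr => bound r (hsub ⟨hr.1, hr.2.le⟩)) ⟨ht.1, le_rfl⟩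

theorem RD.mono_on {f f' : ℝ → ℝ} {T : ℝ} (h : RD f f' T) {a b : ℝ} (ha : 0 ≤ a) (hab : a ≤ b)
    (hb : b < T) (bound : ∀ t ∈ Ico a b, 0 ≤ f' t) : f a ≤ f b := by
  have hsub : Icc a b ⊆ Ico 0 T := fun r hr => ⟨ha.trans hr.1, hr.2.trans_lt hb⟩
  exact image_le_of_deriv_right_le_deriv_boundary (f := fun _ => f a) (f' := fun _ => 0)
    continuousOn_const (fun r _ => hasDerivWithinAt_const _ _ _) le_rfl
    (h.1.mono hsub) (fun r hr => h.2 r (hsub ⟨hr.1, hr.2.le⟩)) bound ⟨hab, le_rfl⟩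

theorem RD.neg {f f' : ℝ → ℝ} {T : ℝ} (h : RD f f' T) : RD (fun t => -f t) (fun t => -f' t) T :=
  ⟨h.1.neg, fun t ht => (h.2 t ht).fun_neg⟩

theorem RD.add {f f' g g' : ℝ → ℝ} {T : ℝ} (h : RD f f' T) (k : RD g g' T) :
    RD (fun t => f t + g t) (fun t => f' t + g' t) T :=
  ⟨h.1.add k.1, fun t ht => (h.2 t ht).fun_add (k.2 t ht)⟩

theorem RD.mul {f f' g g' : ℝ → ℝ} {T : ℝ} (h : RD f f' T) (k : RD g g' T) :
    RD (fun t => f t * g t) (fun t => f' t * g t + f t * g' t) T :=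
  ⟨h.1.mul k.1, fun t ht => (h.2 t ht).fun_mul (k.2 t ht)⟩

theorem RD.cmul {f f' : ℝ → ℝ} {T : ℝ} (h : RD f f' T) (c : ℝ) :
    RD (fun t => c * f t) (fun t => c * f' t) T :=
  ⟨h.1.const_mul c, fun t ht => (h.2 t ht).const_mul c⟩

theorem RD.exp {f f' : ℝ → ℝ} {T : ℝ} (h : RD f f' T) :
    RD (fun t => Real.exp (f t)) (fun t => Real.exp (f t) * f' t) T :=
  ⟨h.1.rexp, fun t ht => (h.2 t ht).exp⟩

theorem barrier2 {p q r : ℝ → ℝ} {T : ℝ} (hp : RD p q T) (hq : RD q r T)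
    (hp0 : p 0 = 0) (hq0 : q 0 = 0) (hr : ∀ t ∈ Ico 0 T, 0 ≤ p t → q t = 0 → 0 < r t) :
    ∀ t ∈ Ico 0 T, 0 ≤ p t ∧ 0 ≤ q t := by
  intro τ hτ
  have hsub : Icc 0 τ ⊆ Ico 0 T := fun r hr => ⟨hr.1, hr.2.trans_lt hτ.2⟩
  have key : Icc 0 τ ⊆ {t | 0 ≤ p t ∧ 0 ≤ q t} := by
    apply IsClosed.Icc_subset_of_forall_exists_gt
    · have h1 : ContinuousOn (fun t => (p t, q t)) (Icc 0 τ) :=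
        (hp.1.mono hsub).prodMk (hq.1.mono hsub)
      have := h1.preimage_isClosed_of_isClosed isClosed_Icc
        (isClosed_Ici.prod isClosed_Ici : IsClosed (Ici (0:ℝ) ×ˢ Ici (0:ℝ)))
      convert this using 1
      ext t; simp; tauto
    · simp [hp0, hq0]
    · rintro z ⟨⟨hz1, hz2⟩, hz⟩ w hw
      have hzT : z ∈ Ico 0 T := hsub ⟨hz.1, hz.2.le⟩
      have ev : ∀ᶠ t in 𝓝[>] z, 0 < q t := by
        rcases hz2.eq_or_lt with h | h
        · have hd := (hq.2 z hzT)
          rw [← hasDerivWithinAt_Ioi_iff_Ici, hasDerivWithinAt_iff_tendsto_slope' (by simp)] at hd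
          filter_upwards [hd.eventually (lt_mem_nhds (hr z hzT hz1 h.symm)), self_mem_nhdsWithin]
            with t ht ht2
          rw [slope_def_field, ← h, sub_zero] at ht
          have h3 : 0 < t - z := sub_pos.2 ht2
          exact (div_pos_iff_of_pos_right h3).1 ht
        · have := (hq.2 z hzT).continuousWithinAt
          exact (this.mono Ioi_subset_Ici_self).eventually (lt_mem_nhds h)
      obtain ⟨d, hd, hd2⟩ := mem_nhdsGT_iff_exists_Ioc_subset.1 ev
      have hm : z < min (min d w) τ := by
        have := hz.2
        simp only [lt_min_iff]; exact ⟨⟨hd, hw⟩, this⟩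
      set m := min (min d w) τ
      have hmd : m ≤ d := (min_le_left _ _).trans (min_le_left _ _)
      have hmw : m ≤ w := (min_le_left _ _).trans (min_le_right _ _)
      have hmτ : m ≤ τ := min_le_right _ _
      refine ⟨m, ⟨?_, ?_⟩, hm, hmw⟩
      · refine hz1.trans (hp.mono_on hz.1 hm.le (hmτ.trans_lt hτ.2) ?_)
        intro t ht
        rcases ht.1.eq_or_lt with h | h
        · rw [← h]; exact hz2
        · exact (hd2 ⟨h, ht.2.le.trans hmd⟩ : 0 < q t).le
      · exact (hd2 ⟨hm, hmd⟩ : 0 < q m).le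
  exact key ⟨hτ.1, le_rfl⟩

/-- First-order form of the system with right derivatives. -/
structure Sol (N a b T : ℝ) (x y u v : ℝ → ℝ) : Prop where
  hx : RD x u T
  hy : RD y v T
  hu : RD u (fun t => N - a * Real.exp (-2 * x t) - N / 2 * (u t ^ 2 + u t * v t)) T
  hv : RD v (fun t => N - b * Real.exp (-2 * y t) - N / 2 * (v t ^ 2 + u t * v t)) T
  x0 : x 0 = 0
  y0 : y 0 = 0
  u0 : u 0 = 0
  v0 : v 0 = 0

namespace Sol
variable {N a b T : ℝ} {x y u v : ℝ → ℝ}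

theorem xu (h : Sol N a b T x y u v) (ha : 0 < a) (haN : a < N) :
    ∀ t ∈ Ico 0 T, 0 ≤ x t ∧ 0 ≤ u t := by
  refine barrier2 h.hx h.hu h.x0 h.u0 ?_
  intro t ht hxt hut
  have : Real.exp (-2 * x t) ≤ 1 := Real.exp_le_one_iff.2 (by linarith)
  rw [hut]
  nlinarith

theorem yv (h : Sol N a b T x y u v) (hN : 0 < N) (hb : N < b) :
    ∀ t ∈ Ico 0 T, y t ≤ 0 ∧ v t ≤ 0 := by
  have := barrier2 h.hy.neg h.hv.neg (by simp [h.y0]) (by simp [h.v0]) ?_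
  · intro t ht
    have := this t ht
    constructor <;> linarith [this.1, this.2]
  intro t ht hxt hut
  have : 1 ≤ Real.exp (-2 * y t) := Real.one_le_exp (by linarith)
  have hv : v t = 0 := by linarith
  simp only [hv]
  nlinarith

theorem hle (h : Sol N a b T x y u v) (ha : 0 < a) (hN : 0 < N) (hb : N < b) :
    ∀ t ∈ Ico 0 T, u t + v t ≤ 3 := by
  refine (h.hu.add h.hv).lt_bound (B := fun _ => 3) (B' := fun _ => 0) (by simp [h.u0, h.v0])
    (fun t => hasDerivAt_const _ _) ?_
  intro t ht e
  have h1 : 0 < a * Real.exp (-2 * x t) := by positivity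
  have h2 : 0 < b * Real.exp (-2 * y t) := mul_pos (hN.trans hb) (Real.exp_pos _)
  have h3 : v t = 3 - u t := by linarith
  rw [h3]
  nlinarith

theorem gle (h : Sol N a b T x y u v) (ha : 0 < a) (hN : 0 < N) (hb : N < b) {ε : ℝ}
    (hε : 0 < ε) (hε2 : ε ^ 2 + 3 * N / 2 * ε + ε < b - N) :
    ∀ t ∈ Ico 0 T, v t * Real.exp (y t) ≤ - ε * (1 - Real.exp (-t)) := by
  refine (h.hv.mul h.hy.exp).lt_bound (B' := fun t => - ε * Real.exp (-t))
    (by simp [h.v0]) ?_ ?_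
  · intro t
    have := (((hasDerivAt_id t).neg.exp).const_sub 1).const_mul (-ε)
    simpa using this
  intro t ht e
  have hyv := h.yv hN hb t ht
  have hh := h.hle ha hN hb t ht
  set E := Real.exp (-y t) with hE
  have hE1 : 1 ≤ E := Real.one_le_exp (by linarith [hyv.1])
  have hqE : Real.exp (y t) * E = 1 := by rw [hE, ← Real.exp_add]; simp
  have hE2 : Real.exp (-2 * y t) = E ^ 2 := by
    rw [hE, ← Real.exp_nat_mul]; congr 1; push_cast; ring
  set q := Real.exp (y t) with hq
  have hq0 : 0 < q := Real.exp_pos _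
  have he1 : Real.exp (-t) ≤ 1 := Real.exp_le_one_iff.2 (by linarith [ht.1])
  have he0 : 0 < Real.exp (-t) := Real.exp_pos _
  set m := ε * (1 - Real.exp (-t)) with hm
  have hm0 : 0 ≤ m := mul_nonneg hε.le (by linarith)
  have hmε : m ≤ ε := by nlinarith
  have hv : v t = - m * E := by
    calc v t = v t * (q * E) := by rw [hqE, mul_one]
      _ = (v t * q) * E := by ring
      _ = _ := by rw [e, hm]; ring
  rw [hE2]
  -- main estimate
  have k1 : (N - b * E ^ 2) ≤ -(b - N) * E ^ 2 := by
    have : 1 ≤ E ^ 2 := one_le_pow₀ hE1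
    nlinarith
  have k2 : v t ^ 2 + u t * v t = v t * (u t + v t) := by ring
  have k3 : -(v t * (u t + v t)) ≤ 3 * (m * E) := by
    rw [hv] at hh ⊢
    have : 0 ≤ m * E := by positivity
    nlinarith
  have k4 : (N - b * E ^ 2 - N / 2 * (v t ^ 2 + u t * v t)) + v t ^ 2
      ≤ -(b - N) * E ^ 2 + 3 * N / 2 * (m * E) + m ^ 2 * E ^ 2 := by
    rw [k2]
    have : v t ^ 2 = m ^ 2 * E ^ 2 := by rw [hv]; ring
    rw [this]
    nlinarith
  have k5 : -(b - N) * E ^ 2 + 3 * N / 2 * (m * E) + m ^ 2 * E ^ 2 ≤ -(b - N - 3 * N / 2 * ε - ε ^ 2) * E ^ 2 := by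
    have a1 : m * E ≤ ε * E ^ 2 := by
      have : E ≤ E ^ 2 := by nlinarith
      calc m * E ≤ ε * E := by gcongr
        _ ≤ ε * E ^ 2 := by gcongr
    have a2 : m ^ 2 * E ^ 2 ≤ ε ^ 2 * E ^ 2 := by gcongr
    nlinarith
  have k6 : -(b - N - 3 * N / 2 * ε - ε ^ 2) * E ^ 2 < - ε * E ^ 2 := by
    have : 0 < E ^ 2 := by positivity
    nlinarith
  have k7 : q * E ^ 2 = E := by rw [pow_two, ← mul_assoc, hqE, one_mul]
  calc (N - b * E ^ 2 - N / 2 * (v t ^ 2 + u t * v t)) * q + v t * (q * v t)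
      = q * ((N - b * E ^ 2 - N / 2 * (v t ^ 2 + u t * v t)) + v t ^ 2) := by ring
    _ < q * (- ε * E ^ 2) := by
        apply mul_lt_mul_of_pos_left _ hq0
        linarith
    _ = - ε * E := by linear_combination (-ε) * k7
    _ ≤ - ε * Real.exp (-t) := by nlinarith

theorem time_bound (h : Sol N a b T x y u v) (ha : 0 < a) (hN : 0 < N) (hb : N < b) {ε : ℝ}
    (hε : 0 < ε) (hε2 : ε ^ 2 + 3 * N / 2 * ε + ε < b - N) :
    ∀ t ∈ Ico 0 T, t < 1 + 1 / ε := by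
  have key := h.hy.exp.le_bound (B := fun t => 1 - ε * (t - 1 + Real.exp (-t)))
    (B' := fun t => - ε * (1 - Real.exp (-t))) (by simp [h.y0]) ?_ ?_
  · intro t ht
    have h1 := key t ht
    have h2 := Real.exp_pos (y t)
    have h3 := Real.exp_pos (-t)
    have h4 : ε * (t - 1) < 1 := by nlinarith
    rw [mul_comm, ← lt_div_iff₀ hε] at h4
    linarith
  · intro t
    have h1 : HasDerivAt (fun t : ℝ => Real.exp (-t)) (-Real.exp (-t)) t := by
      simpa using (hasDerivAt_id t).neg.exp
    have h2 : HasDerivAt (fun t : ℝ => t - 1) 1 t := (hasDerivAt_id t).sub_const 1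
    exact (((h2.fun_add h1).const_mul ε).const_sub 1).congr_deriv (by ring)
  · intro t ht
    rw [mul_comm]
    exact h.gle ha hN hb hε hε2 t ht

theorem anti (h : Sol N a b T x y u v) (hN : 0 < N) (hb : N < b) {r t : ℝ} (hr : 0 ≤ r)
    (hrt : r ≤ t) (ht : t < T) : y t ≤ y r := by
  have := h.hy.neg.mono_on hr hrt ht (fun z hz => by
    have := (h.yv hN hb z ⟨hr.trans hz.1, hz.2.trans ht⟩).2
    simpa using this)
  linarith

theorem bounded (h : Sol N a b T x y u v) (ha : 0 < a) (haN : a < N) (hb : N < b) {L : ℝ}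
    (hL : ∀ t ∈ Ico 0 T, L ≤ y t) :
    ∃ M, ∀ t ∈ Ico 0 T, |x t| ≤ M ∧ |y t| ≤ M ∧ |u t| ≤ M ∧ |v t| ≤ M := by
  have hN : 0 < N := ha.trans haN
  have hb0 : 0 < b := hN.trans hb
  have hxu := h.xu ha haN
  have hyv := h.yv hN hb
  have hh := h.hle ha hN hb
  have hw : ∀ t ∈ Ico 0 T, x t + y t ≤ 3 * t := by
    refine (h.hx.add h.hy).le_bound (B' := fun _ => 3) (by simp [h.x0, h.y0]) ?_ hh
    intro t; simpa using (hasDerivAt_id t).const_mul 3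
  set P := Real.exp (N / 2 * (3 * T)) with hP
  set c := Real.exp (N / 2 * L) with hc
  have hc0 : 0 < c := Real.exp_pos _
  have hP0 : 0 < P := Real.exp_pos _
  set φ := fun t => Real.exp (N / 2 * (x t + y t)) with hφ
  have hφP : ∀ t ∈ Ico 0 T, φ t ≤ P := by
    intro t ht
    apply Real.exp_le_exp.2
    have := hw t ht
    have := ht.2
    gcongr
    linarith
  have hφc : ∀ t ∈ Ico 0 T, c ≤ φ t := by
    intro t ht
    apply Real.exp_le_exp.2
    have := hL t ht
    have := (hxu t ht).1
    gcongr
    linarith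
  have hφ' : RD φ (fun t => φ t * (N / 2 * (u t + v t))) T := ((h.hx.add h.hy).cmul (N / 2)).exp
  have hu : ∀ t ∈ Ico 0 T, u t * φ t ≤ N * P * t := by
    refine (h.hu.mul hφ').le_bound (B' := fun _ => N * P) (by simp [h.u0]) ?_ ?_
    · intro t; simpa using (hasDerivAt_id t).const_mul (N * P)
    intro t ht
    have h1 : 0 < a * Real.exp (-2 * x t) := by positivity
    have h2 := hφP t ht
    have h3 : 0 < φ t := Real.exp_pos _
    calc _ = (N - a * Real.exp (-2 * x t)) * φ t := by ring
      _ ≤ N * φ t := by gcongr; linarith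
      _ ≤ N * P := by gcongr
  set C := b * Real.exp (-2 * L) with hC
  have hC0 : 0 < C := by positivity
  have hv : ∀ t ∈ Ico 0 T, -(v t * φ t) ≤ C * P * t := by
    refine (h.hv.mul hφ').neg.le_bound (B' := fun _ => C * P) (by simp [h.v0]) ?_ ?_
    · intro t; simpa using (hasDerivAt_id t).const_mul (C * P)
    intro t ht
    have h1 : b * Real.exp (-2 * y t) ≤ C := by
      have := hL t ht
      have h2 : -2 * y t ≤ -2 * L := by linarith
      rw [hC]; gcongr
    have h2 := hφP t ht
    have h3 : 0 < φ t := Real.exp_pos _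
    calc _ = (b * Real.exp (-2 * y t) - N) * φ t := by ring
      _ ≤ C * φ t := by gcongr; linarith
      _ ≤ C * P := by gcongr
  refine ⟨max (max (3 * T - L) (-L)) (max (N * P * T / c) (C * P * T / c)), ?_⟩
  intro t ht
  have h1 := hxu t ht
  have h2 := hyv t ht
  have h3 := hw t ht
  have h4 := hL t ht
  have h5 := hφc t ht
  rw [abs_of_nonneg h1.1, abs_of_nonneg h1.2, abs_of_nonpos h2.1, abs_of_nonpos h2.2]
  simp only [le_max_iff]
  refine ⟨Or.inl (Or.inl (by linarith [ht.2])), Or.inl (Or.inr (by linarith)),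
    Or.inr (Or.inl ?_), Or.inr (Or.inr ?_)⟩
  · rw [le_div_iff₀ hc0]
    calc u t * c ≤ u t * φ t := by gcongr; exact h1.2
      _ ≤ N * P * t := hu t ht
      _ ≤ N * P * T := by gcongr; exact ht.2.le
  · rw [le_div_iff₀ hc0]
    calc -v t * c ≤ -v t * φ t := by gcongr; linarith [h2.2]
      _ = -(v t * φ t) := by ring
      _ ≤ C * P * t := hv t ht
      _ ≤ C * P * T := by gcongr; exact ht.2.le

end Sol

/-- The half-open time interval. -/
def TS (Tp : EReal) : Set ℝ := {t : ℝ | 0 ≤ t ∧ (t : EReal) < Tp}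

theorem isOpen_lt_ereal (Tp : EReal) : IsOpen {t : ℝ | (t : EReal) < Tp} :=
  isOpen_Iio.preimage continuous_coe_real_ereal

theorem hasDeriv_interior {x : ℝ → ℝ} {Tp : EReal} (hx : ContDiffOn ℝ 2 x (TS Tp)) {t : ℝ}
    (ht0 : 0 < t) (ht : (t : EReal) < Tp) :
    HasDerivAt x (deriv x t) t ∧ HasDerivAt (deriv x) (deriv (deriv x) t) t := by
  have ho : IsOpen (Ioi (0:ℝ) ∩ {t : ℝ | (t : EReal) < Tp}) := isOpen_Ioi.inter (isOpen_lt_ereal Tp)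
  have h1 : ContDiffOn ℝ (1 + 1) x (Ioi (0:ℝ) ∩ {t : ℝ | (t : EReal) < Tp}) := by
    have : ContDiffOn ℝ 2 x (Ioi (0:ℝ) ∩ {t : ℝ | (t : EReal) < Tp}) :=
      hx.mono (fun r hr => ⟨le_of_lt hr.1, hr.2⟩)
    convert this using 1
    norm_num
  rw [contDiffOn_succ_iff_deriv_of_isOpen ho] at h1
  have hn := ho.mem_nhds ⟨ht0, ht⟩
  exact ⟨(h1.1.differentiableAt hn).hasDerivAt,
    ((h1.2.2.differentiableOn (by norm_num)).differentiableAt hn).hasDerivAt⟩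

theorem rd_of_contDiff {x : ℝ → ℝ} {Tp : EReal} (hx : ContDiffOn ℝ 2 x (TS Tp))
    (h0 : deriv (deriv x) 0 ≠ 0) {T : ℝ} (hT : (T : EReal) ≤ Tp) :
    RD x (deriv x) T ∧ RD (deriv x) (deriv (deriv x)) T := by
  have hlt : ∀ t ∈ Ico 0 T, (t : EReal) < Tp := fun t ht =>
    lt_of_lt_of_le (EReal.coe_lt_coe_iff.2 ht.2) hT
  have hd0 : HasDerivAt (deriv x) (deriv (deriv x) 0) 0 :=
    (differentiableAt_of_deriv_ne_zero h0).hasDerivAt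
  have hcx : ContinuousOn x (Ico 0 T) :=
    hx.continuousOn.mono (fun t ht => ⟨ht.1, hlt t ht⟩)
  have hcd : ∀ t ∈ Ico 0 T, HasDerivAt (deriv x) (deriv (deriv x) t) t := by
    intro t ht
    rcases ht.1.eq_or_lt with h | h
    · rw [← h]; exact hd0
    · exact (hasDeriv_interior hx h (hlt t ht)).2
  refine ⟨⟨hcx, ?_⟩, ⟨fun t ht => (hcd t ht).continuousAt.continuousWithinAt,
    fun t ht => (hcd t ht).hasDerivWithinAt⟩⟩
  intro t ht
  rcases ht.1.eq_or_lt with h | h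
  · subst h
    refine hasDerivWithinAt_Ici_of_tendsto_deriv (s := Ioo 0 T) ?_ ?_ ?_ ?_
    · intro r hr
      exact (hasDeriv_interior hx hr.1 (hlt r ⟨hr.1.le, hr.2⟩)).1.differentiableAt.differentiableWithinAt
    · exact (hcx 0 ht).mono Ioo_subset_Ico_self
    · exact Ioo_mem_nhdsGT ht.2
    · exact hd0.continuousAt.continuousWithinAt
  · exact (hasDeriv_interior hx h (hlt t ht)).1.hasDerivWithinAt

theorem RD.congr_deriv {f f' g : ℝ → ℝ} {T : ℝ} (h : RD f f' T) (e : ∀ t ∈ Ico 0 T, f' t = g t) :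
    RD f g T :=
  ⟨h.1, fun t ht => e t ht ▸ h.2 t ht⟩

theorem glue_hasDerivAt {p q p' q' : ℝ → ℝ} {t₁ T' : ℝ}
    (hp : ∀ t ∈ Ioc 0 t₁, HasDerivAt p (p' t) t) (hq : ∀ t ∈ Ico t₁ T', HasDerivAt q (q' t) t)
    (e : p t₁ = q t₁) (e' : p' t₁ = q' t₁) :
    ∀ t ∈ Ioo 0 T', HasDerivAt (fun t => if t ≤ t₁ then p t else q t)
      (if t ≤ t₁ then p' t else q' t) t := by
  intro t ht
  rcases lt_trichotomy t t₁ with h | h | h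
  · rw [if_pos h.le]
    refine (hp t ⟨ht.1, h.le⟩).congr_of_eventuallyEq ?_
    filter_upwards [Iio_mem_nhds h] with r hr
    rw [if_pos (le_of_lt hr)]
  · subst h
    rw [if_pos le_rfl]
    have h1 : HasDerivWithinAt (fun r => if r ≤ t then p r else q r) (p' t) (Iic t) t :=
      (hp t ⟨ht.1, le_rfl⟩).hasDerivWithinAt.congr (fun r hr => if_pos hr) (if_pos le_rfl)
    have h2 : HasDerivWithinAt (fun r => if r ≤ t then p r else q r) (p' t) (Ici t) t := by
      rw [e']
      refine (hq t ⟨le_rfl, ht.2⟩).hasDerivWithinAt.congr (fun r hr => ?_) ?_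
      · rcases (mem_Ici.1 hr).eq_or_lt with h | h
        · rw [← h]; simp [e]
        · exact if_neg (not_le.2 h)
      · simp [e]
    have := h1.union h2
    rwa [Iic_union_Ici, hasDerivWithinAt_univ] at this
  · rw [if_neg (not_le.2 h)]
    refine (hq t ⟨h.le, ht.2⟩).congr_of_eventuallyEq ?_
    filter_upwards [Ioi_mem_nhds h] with r hr
    rw [if_neg (not_le.2 hr)]

theorem ext_one {x X U G : ℝ → ℝ} {Tp : EReal} {t₁ T' : ℝ} (hx : ContDiffOn ℝ 2 x (TS Tp))
    (ht₁ : 0 < t₁) (ht₁p : (t₁ : EReal) < Tp) (hX : ∀ t, t ≤ t₁ → X t = x t)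
    (hXU : ∀ t ∈ Ioo 0 T', HasDerivAt X (U t) t) (hUG : ∀ t ∈ Ioo 0 T', HasDerivAt U (G t) t)
    (hG : ContinuousOn G (Ioo 0 T')) :
    ContDiffOn ℝ 2 X (TS T') ∧ X 0 = x 0 ∧ deriv X 0 = deriv x 0 ∧
      deriv (deriv X) 0 = deriv (deriv x) 0 ∧
      ∀ t ∈ Ioo 0 T', deriv X t = U t ∧ deriv (deriv X) t = G t := by
  have hev : ∀ t, t < t₁ → X =ᶠ[𝓝 t] x := by
    intro t ht
    filter_upwards [Iio_mem_nhds ht] with r hr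
    exact hX r (le_of_lt hr)
  have hd : ∀ t ∈ Ioo 0 T', deriv X t = U t := fun t ht => (hXU t ht).deriv
  have hdev : ∀ t ∈ Ioo 0 T', deriv X =ᶠ[𝓝 t] U := by
    intro t ht
    filter_upwards [Ioo_mem_nhds ht.1 ht.2] with r hr
    exact hd r hr
  have hdd : ∀ t ∈ Ioo 0 T', deriv (deriv X) t = G t := fun t ht => by
    rw [(hdev t ht).deriv_eq, (hUG t ht).deriv]
  refine ⟨?_, hX 0 ht₁.le, (hev 0 ht₁).deriv_eq, (hev 0 ht₁).deriv.deriv_eq,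
    fun t ht => ⟨hd t ht, hdd t ht⟩⟩
  have hop : ContDiffOn ℝ (1 + 1) X (Ioo 0 T') := by
    rw [contDiffOn_succ_iff_deriv_of_isOpen isOpen_Ioo]
    refine ⟨fun t ht => (hXU t ht).differentiableAt.differentiableWithinAt, by simp, ?_⟩
    have : ContDiffOn ℝ (0 + 1) U (Ioo 0 T') := by
      rw [contDiffOn_succ_iff_deriv_of_isOpen isOpen_Ioo]
      refine ⟨fun t ht => (hUG t ht).differentiableAt.differentiableWithinAt, by simp, ?_⟩
      rw [contDiffOn_zero]
      exact hG.congr (fun t ht => (hUG t ht).deriv)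
    rw [zero_add] at this
    exact this.congr hd
  intro t ht
  have htT : t < T' := EReal.coe_lt_coe_iff.1 ht.2
  rcases lt_or_ge t t₁ with h | h
  · have htp : (t : EReal) < Tp := lt_trans (EReal.coe_lt_coe_iff.2 h) ht₁p
    have h1 : ContDiffWithinAt ℝ 2 x (TS T') t := by
      refine (hx t ⟨ht.1, htp⟩).mono_of_mem_nhdsWithin ?_
      filter_upwards [self_mem_nhdsWithin,
        mem_nhdsWithin_of_mem_nhds ((isOpen_lt_ereal Tp).mem_nhds htp)] with r hr hr2
      exact ⟨hr.1, hr2⟩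
    exact h1.congr_of_eventuallyEq (mem_nhdsWithin_of_mem_nhds (hev t h)) (hX t h.le)
  · have h0 : 0 < t := ht₁.trans_le h
    have := (hop t ⟨h0, htT⟩).contDiffAt (Ioo_mem_nhds h0 htT)
    have e : (1 + 1 : WithTop ℕ∞) = 2 := by norm_num
    rw [e] at this
    exact this.contDiffWithinAt

/-- The vector field. -/
noncomputable def VF (N a b : ℝ) (z : ℝ × ℝ × ℝ × ℝ) : ℝ × ℝ × ℝ × ℝ :=
  (z.2.2.1, z.2.2.2,
    N - a * Real.exp (-2 * z.1) - N / 2 * (z.2.2.1 ^ 2 + z.2.2.1 * z.2.2.2),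
    N - b * Real.exp (-2 * z.2.1) - N / 2 * (z.2.2.2 ^ 2 + z.2.2.1 * z.2.2.2))

theorem VF_contDiff (N a b : ℝ) : ContDiff ℝ 1 (VF N a b) := by
  unfold VF; fun_prop

theorem hasDerivAt_prod4 {f : ℝ → ℝ × ℝ × ℝ × ℝ} {z : ℝ × ℝ × ℝ × ℝ} {t : ℝ}
    (h : HasDerivAt f z t) :
    HasDerivAt (fun t => (f t).1) z.1 t ∧ HasDerivAt (fun t => (f t).2.1) z.2.1 t ∧
    HasDerivAt (fun t => (f t).2.2.1) z.2.2.1 t ∧ HasDerivAt (fun t => (f t).2.2.2) z.2.2.2 t := by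
  have h2 := h.snd
  have h3 := h2.snd
  exact ⟨h.fst, h2.fst, h3.fst, h3.snd⟩

theorem extend_sol {N a b : ℝ} {Tr : ℝ} (hTr : 0 < Tr) {x y u v : ℝ → ℝ}
    (hX : ∀ t ∈ Ioo 0 Tr, HasDerivAt x (u t) t ∧ HasDerivAt y (v t) t ∧
      HasDerivAt u (N - a * Real.exp (-2 * x t) - N / 2 * (u t ^ 2 + u t * v t)) t ∧
      HasDerivAt v (N - b * Real.exp (-2 * y t) - N / 2 * (v t ^ 2 + u t * v t)) t)
    {M : ℝ} (hM : ∀ t ∈ Ico 0 Tr, |x t| ≤ M ∧ |y t| ≤ M ∧ |u t| ≤ M ∧ |v t| ≤ M) :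
    ∃ t₁ ∈ Ioo 0 Tr, ∃ T' > Tr, ∃ X Y U V : ℝ → ℝ,
      (∀ t, t ≤ t₁ → X t = x t) ∧ (∀ t, t ≤ t₁ → Y t = y t) ∧
      ∀ t ∈ Ioo 0 T', HasDerivAt X (U t) t ∧ HasDerivAt Y (V t) t ∧
      HasDerivAt U (N - a * Real.exp (-2 * X t) - N / 2 * (U t ^ 2 + U t * V t)) t ∧
      HasDerivAt V (N - b * Real.exp (-2 * Y t) - N / 2 * (V t ^ 2 + U t * V t)) t := by
  set Z : ℝ → ℝ × ℝ × ℝ × ℝ := fun t => (x t, y t, u t, v t) with hZ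
  have hK : IsCompact (Metric.closedBall (0 : ℝ × ℝ × ℝ × ℝ) M) := isCompact_closedBall _ _
  have hZK : ∀ᶠ t in 𝓝[<] Tr, Z t ∈ Metric.closedBall (0 : ℝ × ℝ × ℝ × ℝ) M := by
    filter_upwards [Ioo_mem_nhdsLT hTr] with t ht
    have := hM t ⟨ht.1.le, ht.2⟩
    simp only [mem_closedBall_zero_iff, hZ, Prod.norm_def, Real.norm_eq_abs, max_le_iff]
    tauto
  obtain ⟨z₀, -, hz₀⟩ := hK.exists_mapClusterPt_of_frequently hZK.frequently
  obtain ⟨r, hr, ε, hε, H⟩ :=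
    (VF_contDiff N a b).contDiffAt.exists_forall_mem_closedBall_exists_eq_forall_mem_Ioo_hasDerivAt
      (x₀ := z₀) 0
  have hfr := (mapClusterPt_iff_frequently.1 hz₀) _ (Metric.closedBall_mem_nhds z₀ hr)
  have hev : ∀ᶠ t in 𝓝[<] Tr, t ∈ Ioo (max 0 (Tr - ε)) Tr :=
    Ioo_mem_nhdsLT (by simp [hTr, hε])
  obtain ⟨t₁, h1, h2⟩ := (hfr.and_eventually hev).exists
  obtain ⟨h3, h4⟩ := max_lt_iff.1 h2.1
  obtain ⟨α, hα0, hα⟩ := H _ h1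
  have hf : ∀ t ∈ Ico t₁ (t₁ + ε), HasDerivAt (fun t => α (t - t₁)) (VF N a b (α (t - t₁))) t := by
    intro t ht
    have := hα (t - t₁) ⟨by linarith [ht.1], by linarith [ht.2]⟩
    exact this.comp_sub_const t t₁
  have hf4 := fun t ht => hasDerivAt_prod4 (hf t ht)
  have e0 : α (t₁ - t₁) = Z t₁ := by rw [sub_self, hα0]
  have hX' : ∀ t ∈ Ioc 0 t₁, _ := fun t ht => hX t ⟨ht.1, ht.2.trans_lt h2.2⟩
  refine ⟨t₁, ⟨h3, h2.2⟩, t₁ + ε, by linarith,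
    fun t => if t ≤ t₁ then x t else (α (t - t₁)).1,
    fun t => if t ≤ t₁ then y t else (α (t - t₁)).2.1,
    fun t => if t ≤ t₁ then u t else (α (t - t₁)).2.2.1,
    fun t => if t ≤ t₁ then v t else (α (t - t₁)).2.2.2,
    fun t ht => if_pos ht, fun t ht => if_pos ht, fun t ht => ⟨?_, ?_, ?_, ?_⟩⟩
  · have := glue_hasDerivAt (fun t ht => (hX' t ht).1) (fun t ht => (hf4 t ht).1)
      (by simp [hα0, hZ]) (by simp [hα0, hZ, VF]) t ht
    exact this
  · have := glue_hasDerivAt (fun t ht => (hX' t ht).2.1) (fun t ht => (hf4 t ht).2.1)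
      (by simp [hα0, hZ]) (by simp [hα0, hZ, VF]) t ht
    exact this
  · have := glue_hasDerivAt (fun t ht => (hX' t ht).2.2.1) (fun t ht => (hf4 t ht).2.2.1)
      (by simp [hα0, hZ]) (by simp [hα0, hZ, VF]) t ht
    convert this using 1
    by_cases h : t ≤ t₁ <;> simp [h, VF]
  · have := glue_hasDerivAt (fun t ht => (hX' t ht).2.2.2) (fun t ht => (hf4 t ht).2.2.2)
      (by simp [hα0, hZ]) (by simp [hα0, hZ, VF]) t ht
    convert this using 1
    by_cases h : t ≤ t₁ <;> simp [h, VF]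

/-- For `n ≥ 3` and `s > (n−1)/(n−2)`, a maximal (non-extendable) C² solution of `(S_s)`
with zero initial data on `[0, T₊)`, `T₊ ∈ (0,∞]`, has `T₊ < ∞` and `y(t) → −∞` as
`t → T₊⁻`. -/
theorem maximal_solution_blowup
    (n : ℕ) (hn : 3 ≤ n) (s : ℝ) (hs : ((n : ℝ) - 1) / ((n : ℝ) - 2) < s)
    (Tp : EReal) (hTp : 0 < Tp) (x y : ℝ → ℝ)
    (hx : ContDiffOn ℝ 2 x {t : ℝ | 0 ≤ t ∧ (t : EReal) < Tp})
    (hy : ContDiffOn ℝ 2 y {t : ℝ | 0 ≤ t ∧ (t : EReal) < Tp})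
    (hsys : SysS n s x y {t : ℝ | 0 ≤ t ∧ (t : EReal) < Tp})
    (hinit : ZeroInit x y)
    (hmax : ¬ ∃ T' : EReal, Tp < T' ∧ ∃ x' y' : ℝ → ℝ,
        ContDiffOn ℝ 2 x' {t : ℝ | 0 ≤ t ∧ (t : EReal) < T'} ∧
        ContDiffOn ℝ 2 y' {t : ℝ | 0 ≤ t ∧ (t : EReal) < T'} ∧
        SysS n s x' y' {t : ℝ | 0 ≤ t ∧ (t : EReal) < T'} ∧ ZeroInit x' y') :
    ∃ Tr : ℝ, Tp = (Tr : EReal) ∧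
      Filter.Tendsto y (nhdsWithin Tr (Set.Iio Tr)) Filter.atBot := by
  classical
  have hn3 : (3 : ℝ) ≤ (n : ℝ) := by exact_mod_cast hn
  set N : ℝ := (n : ℝ) with hNdef
  have hN : 0 < N := by linarith
  have hs0 : 0 < s := lt_trans (div_pos (by linarith) (by linarith)) hs
  set a : ℝ := 1 / s * (N - 1) with ha_def
  set b : ℝ := (2 - 1 / s) * (N - 1) with hb_def
  have ha : 0 < a := mul_pos (by positivity) (by linarith)
  have ha2 : a < N - 2 := by
    rw [div_lt_iff₀ (by linarith)] at hs
    rw [ha_def, one_div, inv_mul_lt_iff₀ hs0]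
    exact hs
  have haN : a < N := by linarith
  have hab : b = 2 * (N - 1) - a := by rw [ha_def, hb_def]; ring
  have hb : N < b := by linarith
  obtain ⟨hx0, hy0, hu0, hv0⟩ := hinit
  have hx' : ContDiffOn ℝ 2 x (TS Tp) := hx
  have hy' : ContDiffOn ℝ 2 y (TS Tp) := hy
  have hs00 := hsys 0 ⟨le_rfl, hTp⟩
  simp only [hx0, hy0, hu0, hv0] at hs00
  have hxx : deriv (deriv x) 0 ≠ 0 := by
    rw [hs00.1]; intro h; simp only [mul_zero, Real.exp_zero] at h; nlinarith
  have hyy : deriv (deriv y) 0 ≠ 0 := by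
    rw [hs00.2]; intro h; simp only [mul_zero, Real.exp_zero] at h; nlinarith
  have hsol : ∀ T : ℝ, (T : EReal) ≤ Tp → Sol N a b T x y (deriv x) (deriv y) := by
    intro T hT
    have hlt : ∀ t ∈ Ico 0 T, (t : EReal) < Tp := fun t ht =>
      lt_of_lt_of_le (EReal.coe_lt_coe_iff.2 ht.2) hT
    have h1 := rd_of_contDiff hx' hxx hT
    have h2 := rd_of_contDiff hy' hyy hT
    exact ⟨h1.1, h2.1, h1.2.congr_deriv (fun t ht => (hsys t ⟨ht.1, hlt t ht⟩).1),
      h2.2.congr_deriv (fun t ht => (hsys t ⟨ht.1, hlt t ht⟩).2), hx0, hy0, hu0, hv0⟩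
  obtain ⟨ε, hε, hε2⟩ : ∃ ε : ℝ, 0 < ε ∧ ε ^ 2 + 3 * N / 2 * ε + ε < b - N := by
    have hc : Tendsto (fun ε : ℝ => ε ^ 2 + 3 * N / 2 * ε + ε) (𝓝[>] 0) (𝓝 0) := by
      have : Continuous (fun ε : ℝ => ε ^ 2 + 3 * N / 2 * ε + ε) := by fun_prop
      have h := (this.tendsto 0).mono_left (nhdsWithin_le_nhds (s := Ioi 0))
      simpa using h
    obtain ⟨ε, h1, h2⟩ := ((hc.eventually (gt_mem_nhds (sub_pos.2 hb))).and
      self_mem_nhdsWithin).exists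
    exact ⟨ε, h2, h1⟩
  have hTtop : Tp ≠ ⊤ := by
    intro h
    have h1 := (hsol (2 + 1 / ε) (by rw [h]; exact le_top)).time_bound ha hN hb hε hε2 (1 + 1 / ε)
      ⟨by positivity, by linarith⟩
    exact lt_irrefl _ h1
  have hTbot : Tp ≠ ⊥ := ne_bot_of_gt hTp
  lift Tp to ℝ using ⟨hTtop, hTbot⟩ with Tr
  refine ⟨Tr, rfl, ?_⟩
  have hTr : 0 < Tr := by exact_mod_cast hTp
  have S := hsol Tr le_rfl
  rw [tendsto_atBot]
  by_contra! hnot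
  obtain ⟨L, hL⟩ := hnot
  have hLy : ∀ t ∈ Ico 0 Tr, L ≤ y t := by
    intro t ht
    obtain ⟨r, hr, hr2⟩ := (hL.and_eventually (Ioo_mem_nhdsLT ht.2)).exists
    have := S.anti hN hb ht.1 hr2.1.le hr2.2
    linarith
  obtain ⟨M, hM⟩ := S.bounded ha haN hb hLy
  obtain ⟨t₁, ht₁, T', hT', X, Y, U, V, hXx, hYy, hD⟩ := extend_sol (N := N) (a := a) (b := b) hTr
    (x := x) (y := y) (u := deriv x) (v := deriv y) (by
      intro t ht
      have hlt : (t : EReal) < (Tr : EReal) := EReal.coe_lt_coe_iff.2 ht.2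
      have h1 := hasDeriv_interior hx' ht.1 hlt
      have h2 := hasDeriv_interior hy' ht.1 hlt
      have h3 := hsys t ⟨ht.1.le, hlt⟩
      exact ⟨h1.1, h2.1, h3.1 ▸ h1.2, h3.2 ▸ h2.2⟩) hM
  have ht₁p : (t₁ : EReal) < (Tr : EReal) := EReal.coe_lt_coe_iff.2 ht₁.2
  have cX : ContinuousOn X (Ioo 0 T') := fun t ht => (hD t ht).1.continuousAt.continuousWithinAt
  have cY : ContinuousOn Y (Ioo 0 T') := fun t ht => (hD t ht).2.1.continuousAt.continuousWithinAt
  have cU : ContinuousOn U (Ioo 0 T') := fun t ht => (hD t ht).2.2.1.continuousAt.continuousWithinAt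
  have cV : ContinuousOn V (Ioo 0 T') := fun t ht => (hD t ht).2.2.2.continuousAt.continuousWithinAt
  obtain ⟨x1, x2, x3, x4, x5⟩ := ext_one hx' ht₁.1 ht₁p hXx (fun t ht => (hD t ht).1)
    (fun t ht => (hD t ht).2.2.1) (by fun_prop)
  obtain ⟨y1, y2, y3, y4, y5⟩ := ext_one hy' ht₁.1 ht₁p hYy (fun t ht => (hD t ht).2.1)
    (fun t ht => (hD t ht).2.2.2) (by fun_prop)
  refine hmax ⟨(T' : EReal), EReal.coe_lt_coe_iff.2 hT', X, Y, x1, y1, ?_,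
    x2.trans hx0, y2.trans hy0, x3.trans hu0, y3.trans hv0⟩
  intro t ht
  have htT : t < T' := EReal.coe_lt_coe_iff.1 ht.2
  rcases ht.1.eq_or_lt with h | h
  · subst h
    rw [x4, y4, x3, y3, x2, y2]
    exact hsys 0 ⟨le_rfl, hTp⟩
  · have p := x5 t ⟨h, htT⟩
    have q := y5 t ⟨h, htT⟩
    rw [p.1, p.2, q.1, q.2]
    exact ⟨rfl, rfl⟩
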